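/- Potential decrease from rerouting load: in a nonatomic congestion game with nondecreasing edge cost functions, let x ∈ 𝒦, let i be a player, let s₁, s₀ ∈ 𝒮_i, and let 0 ≤ Δ ≤ x_{i,s₁}. Define z from x by decreasing the coordinate x_{i,s₁} by Δ and increasing the coordinate x_{i,s₀} by Δ (all other coordinates unchanged). Then Φ(x) − Φ(z) ≥ Δ · (c_{s₁}(z) − c_{s₀}(z)). -/

import Mathlib

open Finset MeasureTheory

/-- The load on edge `e` induced by the strategy profile `x`. -/
noncomputable def load {n : ℕ} {E : Type*} [Fintype E] [DecidableEq E]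
    (S : Fin n → Finset (Finset E)) (x : Fin n → Finset E → ℝ) (e : E) : ℝ :=
  ∑ i, ∑ s ∈ (S i).filter (fun s => e ∈ s), x i s

/-- The cost of a path `s`: `c_s(x) = Σ_{e∈s} c_e(ℓ_e(x))`. -/
noncomputable def pathCost {n : ℕ} {E : Type*} [Fintype E] [DecidableEq E]
    (S : Fin n → Finset (Finset E)) (c : E → ℝ → ℝ)
    (x : Fin n → Finset E → ℝ) (s : Finset E) : ℝ :=
  ∑ e ∈ s, c e (load S x e)

/-- The potential function `Φ(x) = Σ_{e∈E} ∫_0^{ℓ_e(x)} c_e(y) dy`. -/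
noncomputable def potential {n : ℕ} {E : Type*} [Fintype E] [DecidableEq E]
    (S : Fin n → Finset (Finset E)) (c : E → ℝ → ℝ)
    (x : Fin n → Finset E → ℝ) : ℝ :=
  ∑ e : E, ∫ y in (0:ℝ)..(load S x e), c e y

/-- `x` is a feasible strategy profile. -/
def IsProfile {n : ℕ} {E : Type*} [Fintype E] [DecidableEq E]
    (S : Fin n → Finset (Finset E)) (x : Fin n → Finset E → ℝ) : Prop :=
  (∀ i s, 0 ≤ x i s) ∧ (∀ i, ∀ s ∉ S i, x i s = 0) ∧ (∀ i, ∑ s ∈ S i, x i s = 1 / (n:ℝ))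

theorem load_mem_aux {n : ℕ} (hn : 0 < n) {E : Type*} [Fintype E] [DecidableEq E]
    (S : Fin n → Finset (Finset E)) (x : Fin n → Finset E → ℝ) (hx : IsProfile S x) (e : E) :
    load S x e ∈ Set.Icc (0:ℝ) 1 := by
  obtain ⟨h0, -, h1⟩ := hx
  constructor
  · exact Finset.sum_nonneg fun i _ => Finset.sum_nonneg fun s _ => h0 i s
  · have hn' : (n:ℝ) ≠ 0 := by positivity
    calc load S x e ≤ ∑ i, ∑ s ∈ S i, x i s :=
          Finset.sum_le_sum fun i _ => Finset.sum_le_sum_of_subset_of_nonneg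
            (Finset.filter_subset _ _) fun s _ _ => h0 i s
      _ = 1 := by simp [h1, hn']

theorem sum_ind_aux {n : ℕ} {E : Type*} [DecidableEq E]
    (T : Fin n → Finset (Finset E)) (i : Fin n) (s : Finset E) (d : ℝ) (j : Fin n) :
    ∑ r ∈ T j, (if j = i ∧ r = s then d else 0) = if j = i then (if s ∈ T i then d else 0) else 0 := by
  by_cases h : j = i
  · subst h
    simp
  · simp [h]

theorem key_aux (f : ℝ → ℝ) (hm : MonotoneOn f (Set.Icc 0 1))
    (hi : IntervalIntegrable f volume 0 1) (a b : ℝ) (ha : a ∈ Set.Icc (0:ℝ) 1)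
    (hb : b ∈ Set.Icc (0:ℝ) 1) :
    f b * (a - b) ≤ (∫ y in (0:ℝ)..a, f y) - ∫ y in (0:ℝ)..b, f y := by
  have sub : ∀ u ∈ Set.Icc (0:ℝ) 1, ∀ v ∈ Set.Icc (0:ℝ) 1, IntervalIntegrable f volume u v := by
    intro u hu v hv
    apply hi.mono_set
    rw [Set.uIcc_of_le (zero_le_one' ℝ)]
    exact Set.uIcc_subset_Icc hu hv
  have z0 : (0:ℝ) ∈ Set.Icc (0:ℝ) 1 := by simp
  rw [intervalIntegral.integral_interval_sub_left (sub 0 z0 a ha) (sub 0 z0 b hb)]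
  rcases le_total b a with h | h
  · have := intervalIntegral.integral_mono_on (f := fun _ => f b) h (by simp) (sub b hb a ha)
      (fun y hy => hm hb ⟨hb.1.trans hy.1, hy.2.trans ha.2⟩ hy.1)
    simp at this
    linarith
  · have := intervalIntegral.integral_mono_on (g := fun _ => f b) h (sub a ha b hb) (by simp)
      (fun y hy => hm ⟨ha.1.trans hy.1, hy.2.trans hb.2⟩ hb hy.2)
    simp at this
    rw [intervalIntegral.integral_symm]
    linarith

/-- potential decrease from rerouting load.  With nondecreasing
(integrable) edge costs, moving an amount `Δ ∈ [0, x_{i,s₁}]` of player `i`'s load from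
path `s₁` to path `s₀` (producing the profile `z`) decreases the potential by at least
`Δ·(c_{s₁}(z) − c_{s₀}(z))`. -/
theorem potential_decrease_reroute
    {n : ℕ} (hn : 0 < n) {E : Type*} [Fintype E] [DecidableEq E]
    (S : Fin n → Finset (Finset E))
    (hSne : ∀ i, (S i).Nonempty)
    (hpaths : ∀ i, ∀ s ∈ S i, s.Nonempty)
    (c : E → ℝ → ℝ)
    (hmono : ∀ e, MonotoneOn (c e) (Set.Icc 0 1))
    (hint : ∀ e, IntervalIntegrable (c e) volume 0 1)
    (x : Fin n → Finset E → ℝ) (hx : IsProfile S x)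
    (i : Fin n) (s₁ s₀ : Finset E) (hs₁ : s₁ ∈ S i) (hs₀ : s₀ ∈ S i)
    (Δ : ℝ) (hΔ0 : 0 ≤ Δ) (hΔ1 : Δ ≤ x i s₁)
    (z : Fin n → Finset E → ℝ)
    (hz : z = fun j r => x j r + (if j = i ∧ r = s₀ then Δ else 0)
                               - (if j = i ∧ r = s₁ then Δ else 0)) :
    Δ * (pathCost S c z s₁ - pathCost S c z s₀)
      ≤ potential S c x - potential S c z := by
  have hzp : IsProfile S z := by
    obtain ⟨h0, h1, h2⟩ := hx
    refine ⟨?_, ?_, ?_⟩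
    · intro j r
      have := h0 j r
      rw [hz]
      dsimp only
      by_cases h : j = i ∧ r = s₁
      · obtain ⟨rfl, rfl⟩ := h
        split_ifs <;> simp_all <;> linarith
      · rw [if_neg h]
        split_ifs <;> linarith
    · intro j r hr
      have a0 : ¬ (j = i ∧ r = s₀) := by rintro ⟨rfl, rfl⟩; exact hr hs₀
      have a1 : ¬ (j = i ∧ r = s₁) := by rintro ⟨rfl, rfl⟩; exact hr hs₁
      simp [hz, a0, a1, h1 j r hr]
    · intro j
      rw [hz]
      simp only [Finset.sum_sub_distrib, Finset.sum_add_distrib, sum_ind_aux, h2, hs₀, hs₁]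
      simp
  have hload : ∀ e, load S z e = load S x e + (if e ∈ s₀ then Δ else 0)
      - (if e ∈ s₁ then Δ else 0) := by
    intro e
    have A := fun s j => sum_ind_aux (fun j => (S j).filter (fun s => e ∈ s)) i s Δ j
    rw [hz]
    simp only [load, Finset.sum_sub_distrib, Finset.sum_add_distrib, A]
    simp [hs₀, hs₁]
  have hP : ∀ s : Finset E, Δ * pathCost S c z s
      = ∑ e, c e (load S z e) * (if e ∈ s then Δ else 0) := by
    intro s
    simp [pathCost, Finset.mul_sum, mul_comm]
  rw [mul_sub, hP, hP, potential, potential, ← Finset.sum_sub_distrib, ← Finset.sum_sub_distrib]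
  refine Finset.sum_le_sum fun e _ => ?_
  have := key_aux (c e) (hmono e) (hint e) _ _ (load_mem_aux hn S x hx e)
    (load_mem_aux hn S z hzp e)
  refine le_trans (le_of_eq ?_) this
  rw [← mul_sub]
  congr 1
  rw [hload e]
  ring
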